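/- Let d ≥ 0 and let α₁,…,α_d and β₁,…,β_d be multiplicative characters of κ with α_i ≠ β_i for every i. Then for every λ ∈ κ: ∏_{i=1}^d (−j(α_i, ᾱ_iβ_i)) · F((α₁,…,α_d), (β₁,…,β_d); λ) = −∑ ∏_{i=1}^d α_i(t_i)·(ᾱ_iβ_i)(1−t_i), where the sum on the right runs over all (t₁,…,t_d) ∈ κ^d with λ·t₁⋯t_d = 1. -/

import Mathlib

/-!
Finite-field hypergeometric functions (Otsubo), basic definitions:
`κ` is a finite field with `q = Fintype.card κ` elements, `ψ` a fixed nontrivial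
additive character, multiplicative characters are `MulChar κ ℂ` (extended by `0`
on `0`, with trivial character `1`).
-/

open scoped Classical

noncomputable section

variable {κ : Type*} [Field κ] [Fintype κ]

instance : Fintype (MulChar κ ℂ) := Fintype.ofFinite _

/-- The Gauss sum `g(φ) = -∑_{x ∈ κ} ψ(x) φ(x)`. -/
def gS (ψ : AddChar κ ℂ) (φ : MulChar κ ℂ) : ℂ := -∑ x : κ, ψ x * φ x

/-- The variant `g°(φ) = q^{δ(φ)} · g(φ)`, where `δ(φ) = 1` iff `φ` is trivial. -/
def gSo (ψ : AddChar κ ℂ) (φ : MulChar κ ℂ) : ℂ :=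
  (if φ = 1 then (Fintype.card κ : ℂ) else 1) * gS ψ φ

/-- The Pochhammer symbol `(α)_ν = g(αν)/g(α)`. -/
def poch (ψ : AddChar κ ℂ) (α ν : MulChar κ ℂ) : ℂ := gS ψ (α * ν) / gS ψ α

/-- The variant Pochhammer symbol `(α)°_ν = g°(αν)/g°(α)`. -/
def pocho (ψ : AddChar κ ℂ) (α ν : MulChar κ ℂ) : ℂ := gSo ψ (α * ν) / gSo ψ α

/-- The (binary) Jacobi sum `j(φ₁,φ₂) = -∑_{x₁+x₂=1} φ₁(x₁) φ₂(x₂)`. -/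
def jac2 (φ₁ φ₂ : MulChar κ ℂ) : ℂ := -∑ t : κ, φ₁ t * φ₂ (1 - t)

/-- The finite hypergeometric function for tuples `𝛂`, `𝛃` of multiplicative characters:
`F(𝛂,𝛃;λ) = (1/(1-q)) ∑_ν (∏ᵢ (αᵢ)_ν / ∏ⱼ (βⱼ)°_ν) ν(λ)`. -/
def FhT (ψ : AddChar κ ℂ) {m n : ℕ} (A : Fin m → MulChar κ ℂ) (B : Fin n → MulChar κ ℂ)
    (l : κ) : ℂ :=
  (1 - (Fintype.card κ : ℂ))⁻¹ *
    ∑ ν : MulChar κ ℂ, ((∏ i, poch ψ (A i) ν) / ∏ j, pocho ψ (B j) ν) * ν l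

theorem gS_eq_neg_gaussSum (ψ : AddChar κ ℂ) (φ : MulChar κ ℂ) : gS ψ φ = -gaussSum φ ψ := by
  simp [gS, gaussSum, mul_comm]

theorem jac2_eq_neg_jacobiSum (φ₁ φ₂ : MulChar κ ℂ) : jac2 φ₁ φ₂ = -jacobiSum φ₁ φ₂ := rfl

theorem card_complex_ne_zero : (Fintype.card κ : ℂ) ≠ 0 :=
  Nat.cast_ne_zero.mpr Fintype.card_ne_zero

theorem gS_ne_zero {ψ : AddChar κ ℂ} (hψ : ψ ≠ 1) (φ : MulChar κ ℂ) : gS ψ φ ≠ 0 := by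
  rw [gS_eq_neg_gaussSum, neg_ne_zero]
  rcases eq_or_ne φ 1 with rfl | hφ
  · simp [gaussSum_one_left hψ]
  · exact gaussSum_ne_zero_of_nontrivial card_complex_ne_zero hφ (AddChar.IsPrimitive.of_ne_one hψ)

theorem gSo_ne_zero {ψ : AddChar κ ℂ} (hψ : ψ ≠ 1) (φ : MulChar κ ℂ) : gSo ψ φ ≠ 0 := by
  refine mul_ne_zero ?_ (gS_ne_zero hψ φ)
  split_ifs
  exacts [card_complex_ne_zero, one_ne_zero]

theorem jacobiSum_mul_gSo {ψ : AddChar κ ℂ} (hψ : ψ ≠ 1) (φ : MulChar κ ℂ) {γ : MulChar κ ℂ}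
    (hγ : γ ≠ 1) : jacobiSum φ γ * gSo ψ (φ * γ) = -(gS ψ φ * gS ψ γ) := by
  simp only [gSo, gS_eq_neg_gaussSum]
  by_cases h : φ * γ = 1
  · obtain rfl : φ = γ⁻¹ := eq_inv_of_mul_eq_one_left h
    have hcard := gaussSum_mul_gaussSum_eq_card hγ (AddChar.IsPrimitive.of_ne_one hψ)
    have hinv := mul_gaussSum_inv_eq_gaussSum γ⁻¹ ψ
    have hsq : γ⁻¹ (-1) = γ (-1) := by
      rw [MulChar.inv_apply', inv_neg, inv_one]
    rw [hsq] at hinv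
    rw [if_pos h, h, gaussSum_one_left hψ, jacobiSum_comm, jacobiSum_nontrivial_inv hγ,
      ← hinv]
    have hinv' : gaussSum γ⁻¹ ψ⁻¹ * gaussSum γ ψ = Fintype.card κ := by rw [mul_comm, hcard]
    linear_combination γ (-1) * hinv'
  · rw [if_neg h]
    linear_combination -jacobiSum_mul_nontrivial h ψ

theorem neg_jac2_mul_poch_div_pocho {ψ : AddChar κ ℂ} (hψ : ψ ≠ 1) {α β : MulChar κ ℂ}
    (h : α ≠ β) (ν : MulChar κ ℂ) :
    -jac2 α (α⁻¹ * β) * (poch ψ α ν / pocho ψ β ν) = jacobiSum (α * ν) (α⁻¹ * β) := by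
  have hγ : α⁻¹ * β ≠ 1 := fun e => h (inv_mul_eq_one.mp e)
  have h₁ := jacobiSum_mul_gSo hψ α hγ
  have h₂ := jacobiSum_mul_gSo hψ (α * ν) hγ
  rw [mul_inv_cancel_left] at h₁
  rw [show α * ν * (α⁻¹ * β) = β * ν by rw [mul_mul_mul_comm, mul_inv_cancel, one_mul, mul_comm] ] at h₂
  have := gS_ne_zero hψ α
  have := gSo_ne_zero hψ β
  have := gSo_ne_zero hψ (β * ν)
  rw [jac2_eq_neg_jacobiSum, neg_neg, poch, pocho]
  field_simp
  linear_combination gS ψ (α * ν) * h₁ - gS ψ α * h₂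

theorem sum_mulChar_apply (x : κ) :
    ∑ ν : MulChar κ ℂ, ν x = if x = 1 then (Fintype.card κ : ℂ) - 1 else 0 := by
  split_ifs with hx
  · subst hx
    have hc : Fintype.card (MulChar κ ℂ) = Fintype.card κ - 1 := by
      rw [← Nat.card_eq_fintype_card, MulChar.card_eq_card_units_of_hasEnoughRootsOfUnity κ ℂ,
        Nat.card_eq_fintype_card, Fintype.card_units]
    simp [hc, Nat.cast_sub Fintype.card_pos]
  · obtain ⟨χ, hχ⟩ := MulChar.exists_apply_ne_one_of_hasEnoughRootsOfUnity κ ℂ hx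
    refine eq_zero_of_mul_eq_self_left hχ ?_
    simp only [Finset.mul_sum, ← MulChar.mul_apply]
    exact Fintype.sum_bijective _ (Group.mulLeft_bijective χ) _ _ fun _ => rfl

/-- sum representation: if `αᵢ ≠ βᵢ` for all `i`, then for all `λ`,
`∏ᵢ (-j(αᵢ,ᾱᵢβᵢ)) · F(𝛂,𝛃;λ) = -∑_{λ t₁⋯t_d = 1} ∏ᵢ αᵢ(tᵢ)(ᾱᵢβᵢ)(1-tᵢ)`. -/
theorem stmt_6 (ψ : AddChar κ ℂ) (hψ : ψ ≠ 1) {d : ℕ}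
    (A B : Fin d → MulChar κ ℂ) (h : ∀ i, A i ≠ B i) (l : κ) :
    (∏ i, -jac2 (A i) ((A i)⁻¹ * B i)) * FhT ψ A B l =
      -∑ t ∈ Finset.univ.filter (fun t : Fin d → κ => l * ∏ i, t i = 1),
          ∏ i, A i (t i) * ((A i)⁻¹ * B i) (1 - t i) := by
  have hq : (1 - (Fintype.card κ : ℂ)) ≠ 0 := by
    rw [sub_ne_zero]
    exact_mod_cast Fintype.one_lt_card.ne
  have hν (ν : MulChar κ ℂ) :
      (∏ i, -jac2 (A i) ((A i)⁻¹ * B i)) *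
          (((∏ i, poch ψ (A i) ν) / ∏ j, pocho ψ (B j) ν) * ν l) =
        ∑ t : Fin d → κ,
          (∏ i, A i (t i) * ((A i)⁻¹ * B i) (1 - t i)) * ν (l * ∏ i, t i) := by
    rw [← Finset.prod_div_distrib, ← mul_assoc, ← Finset.prod_mul_distrib,
      Finset.prod_congr rfl fun i _ => neg_jac2_mul_poch_div_pocho hψ (h i) ν]
    simp only [jacobiSum]
    rw [Finset.prod_univ_sum, Fintype.piFinset_univ, Finset.sum_mul]
    refine Finset.sum_congr rfl fun t _ => ?_
    simp only [MulChar.mul_apply, map_mul, map_prod, Finset.prod_mul_distrib]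
    ring
  rw [FhT, mul_left_comm, Finset.mul_sum, Finset.sum_congr rfl fun ν _ => hν ν, Finset.sum_comm]
  simp only [← Finset.mul_sum, sum_mulChar_apply]
  rw [Finset.sum_filter, ← Finset.sum_neg_distrib, Finset.mul_sum]
  refine Finset.sum_congr rfl fun t _ => ?_
  split_ifs
  · field_simp
    ring
  · simp

end
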